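/- The intersection B_{α-1} ∩ B_{α-α²} is the singleton { -(a-1)·α - α⁻¹ }. -/

import Mathlib

open Complex Filter Topology

noncomputable section

/-- The word `w₁w₂w₃w₄` is lexicographically smaller than the word `(a-1)(a-1)01`. -/
def WordLt (a : ℤ) (w₁ w₂ w₃ w₄ : ℤ) : Prop :=
  w₁ < a - 1 ∨ (w₁ = a - 1 ∧ (w₂ < a - 1 ∨ (w₂ = a - 1 ∧ (w₃ < 0 ∨ (w₃ = 0 ∧ w₄ < 1)))))

/-- A sequence of integers `(c i)_{i ≥ k}` with `0 ≤ c i ≤ a-1` is admissible if for every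
`i ≥ k+3` the word `c i, c (i-1), c (i-2), c (i-3)` is lexicographically smaller
than `(a-1)(a-1)01`. (Values of `c` below index `k` are irrelevant.) -/
def Admissible (a k : ℤ) (c : ℤ → ℤ) : Prop :=
  (∀ i, k ≤ i → 0 ≤ c i ∧ c i ≤ a - 1) ∧
  (∀ i, k + 3 ≤ i → WordLt a (c i) (c (i - 1)) (c (i - 2)) (c (i - 3)))

/-- The Rauzy fractal `R_a = { Σ_{i=2}^∞ c_i α^i : (c_i)_{i≥2} admissible }`. -/
def Rauzy (a : ℤ) (α : ℂ) : Set ℂ :=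
  {z | ∃ c : ℤ → ℤ, Admissible a 2 c ∧
    z = ∑' n : ℕ, (c ((n : ℤ) + 2) : ℂ) * α ^ (n + 2)}

/-- `B_v = R_a ∩ (R_a + v)`. -/
def BSet (a : ℤ) (α : ℂ) (v : ℂ) : Set ℂ :=
  Rauzy a α ∩ ((· + v) '' Rauzy a α)

/-- `B'_{α-1}`: points of `B_{α-1}` admitting an admissible expansion
`z = α - 1 + Σ_{i=3}^∞ c_i α^i` with `c 3 ≠ a-1`. -/
def Bprime (a : ℤ) (α : ℂ) : Set ℂ :=
  {z | z ∈ BSet a α (α - 1) ∧ ∃ c : ℤ → ℤ, Admissible a 3 c ∧ c 3 ≠ a - 1 ∧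
    z = α - 1 + ∑' n : ℕ, (c ((n : ℤ) + 3) : ℂ) * α ^ (n + 3)}

/-- `g_{2k+1}(z) = -1 - k α³ + α³ z`. -/
def gOdd (α : ℂ) (k : ℤ) (z : ℂ) : ℂ := -1 - (k : ℂ) * α ^ 3 + α ^ 3 * z

/-- `g_{2k}(z) = α - 1 + (a-1-k) α³ + α² z`. -/
def gEven (a : ℤ) (α : ℂ) (k : ℤ) (z : ℂ) : ℂ :=
  α - 1 + ((a : ℂ) - 1 - (k : ℂ)) * α ^ 3 + α ^ 2 * z


/-! ### Integer sequences -/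

/-- A bounded integer solution of the carry recurrence has small values. -/
theorem aux_bound (a : ℤ) (ha : 3 ≤ a) (T : ℕ → ℤ) (h0 : T 0 = -1) (h1 : T 1 = 1)
    (hb : ∃ N : ℕ, ∀ n, |T n| ≤ N)
    (hE : ∀ n, |T n - a * T (n + 1) + T (n + 2) - T (n + 3)| ≤ a - 1) :
    (∀ n, |T n| ≤ 1) ∨ (a = 3 ∧ ∀ n, |T n| ≤ 4) ∨ (a = 4 ∧ ∀ n, |T n| ≤ 2) := by
  classical
  obtain ⟨N, hN, hmin⟩ : ∃ N : ℕ, (∀ n, |T n| ≤ N) ∧ ∀ M : ℕ, M < N → ¬ ∀ n, |T n| ≤ M :=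
    ⟨Nat.find hb, Nat.find_spec hb, fun M hM => Nat.find_min hb hM⟩
  -- the dominance inequality
  have key : 2 ≤ N → ((a ^ 2 - 1) * (N : ℤ)) ≤ (a ^ 2 - 1) + 2 * a * N := by
    intro h2
    have := hmin (N - 1) (by omega)
    push Not at this
    obtain ⟨n, hn⟩ := this
    have hcast : ((N - 1 : ℕ) : ℤ) = (N : ℤ) - 1 := by omega
    rw [hcast] at hn
    have hnN : (N : ℤ) ≤ |T n| := by omega
    obtain _ | _ | n := n
    · rw [h0] at hnN; norm_num at hnN; omega
    · simp only [zero_add] at hnN; rw [h1] at hnN; norm_num at hnN; omega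
    have e1 := abs_le.mp (hE n)
    have e2 := abs_le.mp (hE (n + 1))
    have b0 := abs_le.mp (hN n)
    have b3 := abs_le.mp (hN (n + 3))
    have b4 := abs_le.mp (hN (n + 4))
    simp only [add_assoc, Nat.reduceAdd] at *
    have ha0 : 0 ≤ a := by omega
    have ha1 : 0 ≤ a - 1 := by omega
    have ha2 : 0 ≤ a ^ 2 - 1 := by nlinarith
    have p1 := mul_le_mul_of_nonneg_left e2.1 ha0
    have p2 := mul_le_mul_of_nonneg_left e2.2 ha0
    have p3 := mul_le_mul_of_nonneg_left b3.1 ha1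
    have p4 := mul_le_mul_of_nonneg_left b3.2 ha1
    have p5 := mul_le_mul_of_nonneg_left b4.1 ha0
    have p6 := mul_le_mul_of_nonneg_left b4.2 ha0
    rcases le_total 0 (T (n + 2)) with hs | hs
    · rw [abs_of_nonneg hs] at hnN
      have p7 := mul_le_mul_of_nonneg_left hnN ha2
      nlinarith only [p1, p2, p3, p4, p5, p6, p7, e1.1, e1.2, b0.1, b0.2]
    · rw [abs_of_nonpos hs] at hnN
      have p7 := mul_le_mul_of_nonneg_left hnN ha2
      nlinarith only [p1, p2, p3, p4, p5, p6, p7, e1.1, e1.2, b0.1, b0.2]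
  by_cases h1N : N ≤ 1
  · left; intro n; have := hN n; omega
  have h2 : 2 ≤ N := by omega
  have hk := key h2
  have h2' : (2 : ℤ) ≤ N := by exact_mod_cast h2
  by_cases h5 : 5 ≤ a
  · exfalso
    have h3 : 0 ≤ a ^ 2 - 1 - 2 * a := by nlinarith
    have h4 := mul_le_mul_of_nonneg_left h2' h3
    nlinarith
  · right
    have : a = 3 ∨ a = 4 := by omega
    rcases this with rfl | rfl
    · left; refine ⟨rfl, fun n => ?_⟩; have := hN n; omega
    · right; refine ⟨rfl, fun n => ?_⟩; have := hN n; omega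

theorem aux_step (a : ℤ) (ha : 3 ≤ a) (T : ℕ → ℤ)
    (hT : (∀ n, |T n| ≤ 1) ∨ (a = 3 ∧ ∀ n, |T n| ≤ 4) ∨ (a = 4 ∧ ∀ n, |T n| ≤ 2))
    (hE : ∀ n, |T n - a * T (n + 1) + T (n + 2) - T (n + 3)| ≤ a - 1) (n : ℕ)
    (h0 : T n = 1 ∨ T n = -1) (h1 : T (n + 1) = 1 ∨ T (n + 1) = -1) (h2 : T (n + 2) = - T n) :
    T (n + 3) = - T (n + 1) := by
  have e0 := abs_le.mp (hE n)
  have e1 := abs_le.mp (hE (n + 1))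
  have e2 := abs_le.mp (hE (n + 2))
  have e3 := abs_le.mp (hE (n + 3))
  have e4 := abs_le.mp (hE (n + 4))
  have e5 := abs_le.mp (hE (n + 5))
  simp only [add_assoc, Nat.reduceAdd] at e1 e2 e3 e4 e5
  rcases hT with hT | ⟨rfl, hT⟩ | ⟨rfl, hT⟩
  · have b3 := abs_le.mp (hT (n + 3))
    clear e1 e2 e3 e4 e5
    rcases h0 with h0 | h0 <;> rcases h1 with h1 | h1 <;> rw [h2, h0, h1] at e0 <;> rw [h1] <;>
      omega
  · have b3 := abs_le.mp (hT (n + 3))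
    have b4 := abs_le.mp (hT (n + 4))
    have b5 := abs_le.mp (hT (n + 5))
    have b6 := abs_le.mp (hT (n + 6))
    have b7 := abs_le.mp (hT (n + 7))
    have b8 := abs_le.mp (hT (n + 8))
    rcases h0 with h0 | h0 <;> rcases h1 with h1 | h1 <;> omega
  · have b3 := abs_le.mp (hT (n + 3))
    have b4 := abs_le.mp (hT (n + 4))
    have b5 := abs_le.mp (hT (n + 5))
    have b6 := abs_le.mp (hT (n + 6))
    clear e4 e5
    rcases h0 with h0 | h0 <;> rcases h1 with h1 | h1 <;> omega

theorem aux_per (a : ℤ) (ha : 3 ≤ a) (T : ℕ → ℤ) (h0 : T 0 = -1) (h1 : T 1 = 1) (h2 : T 2 = 1)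
    (hb : ∃ N : ℕ, ∀ n, |T n| ≤ N)
    (hE : ∀ n, |T n - a * T (n + 1) + T (n + 2) - T (n + 3)| ≤ a - 1) (n : ℕ) :
    (T n = 1 ∨ T n = -1) ∧ (T (n + 1) = 1 ∨ T (n + 1) = -1) ∧ T (n + 2) = - T n := by
  have hT := aux_bound a ha T h0 h1 hb hE
  induction n with
  | zero => simp [h0, h1, h2]
  | succ n ih =>
    obtain ⟨i0, i1, i2⟩ := ih
    have := aux_step a ha T hT hE n i0 i1 i2
    refine ⟨i1, ?_, this⟩
    show T (n + 2) = 1 ∨ T (n + 2) = -1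
    omega

/-- The sequence of carries. -/
def carry (a : ℤ) (E : ℕ → ℤ) : ℕ → ℤ × ℤ × ℤ
  | 0 => (-1, 1, 1)
  | n + 1 => ((carry a E n).2.1, (carry a E n).2.2,
      (carry a E n).1 - a * (carry a E n).2.1 + (carry a E n).2.2 - E n)

theorem carry_rec (a : ℤ) (E : ℕ → ℤ) : ∃ T : ℕ → ℤ, T 0 = -1 ∧ T 1 = 1 ∧ T 2 = 1 ∧
    ∀ n, E n = T n - a * T (n + 1) + T (n + 2) - T (n + 3) := by
  refine ⟨fun n => (carry a E n).1, rfl, rfl, rfl, fun n => ?_⟩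
  simp only [carry]
  ring

/-! ### The root -/

theorem root_facts (a : ℤ) (ha : 3 ≤ a) (α : ℂ)
    (hroot : α ^ 3 - (a : ℂ) * α ^ 2 + α - 1 = 0) (hα : α.im ≠ 0) :
    α.re ^ 2 + α.im ^ 2 < 1 := by
  have hre := congrArg Complex.re hroot
  have him := congrArg Complex.im hroot
  simp only [pow_succ, pow_zero, one_mul, Complex.sub_re, Complex.add_re, Complex.mul_re,
    Complex.sub_im, Complex.add_im, Complex.mul_im, Complex.one_re, Complex.one_im,
    Complex.intCast_re, Complex.intCast_im, Complex.zero_re, Complex.zero_im] at hre him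
  have ha' : (3 : ℝ) ≤ a := by exact_mod_cast ha
  generalize (a : ℝ) = A at *
  generalize α.re = x at *
  generalize α.im = y at *
  have him' : 3 * x ^ 2 - y ^ 2 - 2 * A * x + 1 = 0 := by
    apply mul_left_cancel₀ hα
    linear_combination him
  have hm : (x ^ 2 + y ^ 2) * (A - 2 * x) = 1 := by
    linear_combination hre - x * him'
  have hm2 : x ^ 2 + y ^ 2 = 1 - 2 * x * (A - 2 * x) := by
    linear_combination - him'
  have hpos : 0 < x ^ 2 + y ^ 2 := by positivity
  have hb : 0 < A - 2 * x := by
    by_contra hcon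
    push Not at hcon
    nlinarith
  by_contra hcon
  push Not at hcon
  have hx : x ≤ 0 := by
    by_contra hx
    push Not at hx
    have := mul_pos hx hb
    nlinarith
  nlinarith

theorem norm_lt (α : ℂ) (h : α.re ^ 2 + α.im ^ 2 < 1) : ‖α‖ < 1 := by
  have h2 : ‖α‖ ^ 2 < 1 := by
    rw [Complex.sq_norm, Complex.normSq_apply]; nlinarith
  nlinarith [norm_nonneg α]

theorem summ (M : ℝ) (α : ℂ) (h : ‖α‖ < 1) (c : ℕ → ℤ) (hc : ∀ n, |(c n : ℝ)| ≤ M) (k : ℕ) :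
    Summable (fun n : ℕ => (c n : ℂ) * α ^ (n + k)) := by
  apply Summable.of_norm_bounded (g := fun n : ℕ => M * ‖α‖ ^ k * ‖α‖ ^ n)
  · exact (summable_geometric_of_lt_one (norm_nonneg _) h).mul_left _
  · intro n
    rw [norm_mul, norm_pow, Complex.norm_intCast, pow_add]
    have := mul_le_mul_of_nonneg_right (hc n)
      (mul_nonneg (pow_nonneg (norm_nonneg α) n) (pow_nonneg (norm_nonneg α) k))
    linarith

theorem norm_tail (M : ℝ) (α : ℂ) (h : ‖α‖ < 1) (c : ℕ → ℤ) (hc : ∀ n, |(c n : ℝ)| ≤ M) :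
    ‖∑' n : ℕ, (c n : ℂ) * α ^ (n + 1)‖ ≤ M * ‖α‖ * (1 - ‖α‖)⁻¹ := by
  apply tsum_of_norm_bounded ((hasSum_geometric_of_lt_one (norm_nonneg _) h).mul_left (M * ‖α‖))
  intro n
  rw [norm_mul, norm_pow, Complex.norm_intCast, pow_succ]
  have := mul_le_mul_of_nonneg_right (hc n)
    (mul_nonneg (pow_nonneg (norm_nonneg α) n) (norm_nonneg α))
  linarith

/-- Boundedness of carries. -/
theorem carry_bdd (a : ℤ) (α : ℂ)
    (hroot : α ^ 3 - (a : ℂ) * α ^ 2 + α - 1 = 0) (hα : α.im ≠ 0)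
    (hm : α.re ^ 2 + α.im ^ 2 < 1) (M : ℝ) (E T : ℕ → ℤ) (hE : ∀ n, |(E n : ℝ)| ≤ M)
    (h0 : T 0 = -1) (h1 : T 1 = 1) (h2 : T 2 = 1)
    (hT : ∀ n, E n = T n - a * T (n + 1) + T (n + 2) - T (n + 3))
    (hsum : ∑' n : ℕ, (E n : ℂ) * α ^ (n + 2) = 1 - α ^ 2) :
    ∃ N : ℕ, ∀ n, |T n| ≤ N := by
  have hn := norm_lt α hm
  have hne : α ≠ 0 := by rintro rfl; simp at hα
  have hinv : α⁻¹ = α ^ 2 - a * α + 1 := by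
    field_simp; linear_combination - hroot
  have hA : ∀ n, ∑' k : ℕ, (E (k + n) : ℂ) * α ^ (k + 1)
      = (T (n + 2) - T (n + 1)) + T (n + 1) * α⁻¹ + T n * α := by
    intro n
    induction n with
    | zero =>
      simp only [add_zero, zero_add, h0, h1, h2]
      apply mul_left_cancel₀ hne
      rw [← tsum_mul_left]
      have : ∀ k : ℕ, α * ((E k : ℂ) * α ^ (k + 1)) = (E k : ℂ) * α ^ (k + 2) := by
        intro k; ring
      simp only [this, hsum]
      push_cast
      field_simp
      ring
    | succ n ih =>
      have hs := summ M α hn (fun k => E (k + n)) (fun k => hE _) 1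
      rw [hs.tsum_eq_zero_add] at ih
      have h3 : ∀ k : ℕ, (E (k + 1 + n) : ℂ) * α ^ (k + 1 + 1)
          = α * ((E (k + (n + 1)) : ℂ) * α ^ (k + 1)) := by
        intro k; rw [show k + 1 + n = k + (n + 1) by ring]; ring
      simp only [h3, tsum_mul_left, zero_add, pow_one] at ih
      apply mul_left_cancel₀ hne
      have hTn : (E n : ℂ) = T n - a * T (n + 1) + T (n + 2) - T (n + 3) := by
        exact_mod_cast hT n
      rw [hTn] at ih
      simp only [add_assoc, Nat.reduceAdd] at ih ⊢
      rw [hinv] at ih ⊢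
      linear_combination ih + (- T (n + 2) : ℂ) * hroot
  set K := M * ‖α‖ * (1 - ‖α‖)⁻¹ with hK
  have hb : ∀ n, |((T (n + 1) - T n * (α.re ^ 2 + α.im ^ 2) : ℝ))| * |α.im|
      ≤ K := by
    intro n
    have h4 := norm_tail M α hn (fun k => E (k + n)) (fun k => hE _)
    rw [hA n] at h4
    have h5 := (Complex.abs_im_le_norm _).trans h4
    have hpos : 0 < α.re ^ 2 + α.im ^ 2 := by positivity
    have h6 : ((T (n + 2) - T (n + 1) : ℂ) + T (n + 1) * α⁻¹ + T n * α).im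
        = - ((T (n + 1) - T n * (α.re ^ 2 + α.im ^ 2) : ℝ) * α.im) / (α.re ^ 2 + α.im ^ 2) := by
      simp only [Complex.add_im, Complex.sub_im, Complex.mul_im, Complex.inv_im, Complex.intCast_re,
        Complex.intCast_im, Complex.normSq_apply]
      have : α.re * α.re + α.im * α.im ≠ 0 := by nlinarith
      rw [show α.re ^ 2 + α.im ^ 2 = α.re * α.re + α.im * α.im by ring]
      field_simp
      ring
    rw [h6, abs_div, abs_neg, abs_mul, abs_of_pos hpos, div_le_iff₀ hpos] at h5
    have hKnn : 0 ≤ K := (norm_nonneg _).trans h4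
    nlinarith
  set m := α.re ^ 2 + α.im ^ 2 with hmdef
  have hmn : 0 ≤ m := by positivity
  have hpi : 0 < |α.im| := abs_pos.mpr hα
  have hb2 : ∀ n, |(T n : ℝ)| ≤ 1 + K / |α.im| / (1 - m) := by
    have hm1 : 0 < 1 - m := by linarith
    have hKnn : 0 ≤ K := le_trans (by positivity) (hb 0)
    have hKp : 0 ≤ K / |α.im| / (1 - m) := by positivity
    intro n
    induction n with
    | zero => rw [h0]; simp; exact hKp
    | succ n ih =>
      have h7 : |((T (n + 1) - T n * m : ℝ))| ≤ K / |α.im| := by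
        rw [le_div_iff₀ hpi]; exact hb n
      have h8 : |(T (n + 1) : ℝ)| ≤ |((T (n + 1) - T n * m : ℝ))| + |(T n : ℝ) * m| := by
        have := abs_add_le ((T (n + 1) - T n * m : ℝ)) ((T n : ℝ) * m)
        simpa using this
      rw [abs_mul, abs_of_nonneg hmn] at h8
      have h9 : K / |α.im| = K / |α.im| / (1 - m) * (1 - m) := by field_simp
      have h10 := mul_le_mul_of_nonneg_right ih hmn
      nlinarith
  obtain ⟨N, hN⟩ := exists_nat_ge (1 + K / |α.im| / (1 - m))
  refine ⟨N, fun n => ?_⟩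
  have := (hb2 n).trans hN
  exact_mod_cast this

/-! ### Periodic expansions -/

/-- The sequence of period four with `a-1` at positions `≡ r, r+1 mod 4`. -/
def per (a r : ℤ) (i : ℤ) : ℤ := if (i - r) % 4 = 0 ∨ (i - r) % 4 = 1 then a - 1 else 0

theorem per_adm (a r : ℤ) (ha : 3 ≤ a) : Admissible a 2 (per a r) := by
  constructor
  · intro i _
    unfold per
    split_ifs <;> omega
  · intro i _
    unfold per WordLt
    split_ifs <;> omega

theorem per_sum (a r : ℤ) (ha : 3 ≤ a) (α : ℂ) (hn : ‖α‖ < 1) :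
    (∑' n : ℕ, (per a r ((n : ℤ) + 2) : ℂ) * α ^ (n + 2)) * (1 - α ^ 4)
      = per a r 2 * α ^ 2 + per a r 3 * α ^ 3 + per a r 4 * α ^ 4 + per a r 5 * α ^ 5 := by
  have hs := summ (a - 1 : ℝ) α hn (fun n : ℕ => per a r ((n : ℤ) + 2)) (by
    intro n
    have := (per_adm a r ha).1 ((n : ℤ) + 2) (by omega)
    have h : |per a r ((n : ℤ) + 2)| ≤ a - 1 := by rw [abs_of_nonneg this.1]; exact this.2
    exact_mod_cast h) 2
  have h1 := hs.sum_add_tsum_nat_add 4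
  have h2 : ∀ n : ℕ, (per a r (((n + 4 : ℕ) : ℤ) + 2) : ℂ) * α ^ (n + 4 + 2)
      = α ^ 4 * ((per a r ((n : ℤ) + 2) : ℂ) * α ^ (n + 2)) := by
    intro n
    have : per a r (((n + 4 : ℕ) : ℤ) + 2) = per a r ((n : ℤ) + 2) := by
      unfold per
      have : (((n + 4 : ℕ) : ℤ) + 2 - r) % 4 = ((n : ℤ) + 2 - r) % 4 := by omega
      rw [this]
    rw [this]; ring
  simp only [h2, tsum_mul_left] at h1
  simp only [Finset.sum_range_succ, Finset.sum_range_zero] at h1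
  norm_num at h1
  linear_combination - h1

theorem per_val (a r : ℤ) (ha : 3 ≤ a) (α : ℂ) (hn : ‖α‖ < 1) (v : ℂ)
    (hv : v * (1 - α ^ 4)
      = per a r 2 * α ^ 2 + per a r 3 * α ^ 3 + per a r 4 * α ^ 4 + per a r 5 * α ^ 5) :
    v = ∑' n : ℕ, (per a r ((n : ℤ) + 2) : ℂ) * α ^ (n + 2) := by
  have h4 : (1 - α ^ 4) ≠ 0 := by
    intro h
    have h1 : α ^ 4 = 1 := by linear_combination - h
    have h2 := congrArg norm h1
    rw [norm_pow, norm_one] at h2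
    have := pow_lt_one₀ (norm_nonneg α) hn (n := 4) (by norm_num)
    linarith
  apply mul_right_cancel₀ h4
  rw [hv, per_sum a r ha α hn]

theorem bset_inter_4 (a : ℤ) (ha : 3 ≤ a) (α : ℂ)
    (hroot : α ^ 3 - (a : ℂ) * α ^ 2 + α - 1 = 0) (hα : α.im ≠ 0) :
    BSet a α (α - 1) ∩ BSet a α (α - α ^ 2) = {-(((a : ℂ) - 1) * α) - α⁻¹} := by
  have hm := root_facts a ha α hroot hα
  have hn := norm_lt α hm
  have hne : α ≠ 0 := by rintro rfl; simp at hα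
  have hinv : α⁻¹ = α ^ 2 - a * α + 1 := by
    field_simp; linear_combination - hroot
  have hP : -(((a : ℂ) - 1) * α) - α⁻¹ = α - 1 - α ^ 2 := by rw [hinv]; ring
  rw [hP]
  have vc : α - 1 - α ^ 2 = ∑' n : ℕ, (per a 1 ((n : ℤ) + 2) : ℂ) * α ^ (n + 2) := by
    apply per_val a 1 ha α hn
    norm_num [per]
    linear_combination (α ^ 3 + 1 : ℂ) * hroot
  have vd : - α ^ 2 = ∑' n : ℕ, (per a 0 ((n : ℤ) + 2) : ℂ) * α ^ (n + 2) := by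
    apply per_val a 0 ha α hn
    norm_num [per]
    linear_combination (α ^ 3 + α ^ 2 : ℂ) * hroot
  have vf : - 1 = ∑' n : ℕ, (per a 2 ((n : ℤ) + 2) : ℂ) * α ^ (n + 2) := by
    apply per_val a 2 ha α hn
    norm_num [per]
    linear_combination (α + 1 : ℂ) * hroot
  ext z
  simp only [Set.mem_inter_iff, BSet, Set.mem_image, Set.mem_singleton_iff]
  constructor
  · rintro ⟨⟨-, x, ⟨d, hd, hx⟩, hxz⟩, ⟨-, y, ⟨f, hf, hy⟩, hyz⟩⟩
    have hdb : ∀ n : ℕ, 0 ≤ d ((n : ℤ) + 2) ∧ d ((n : ℤ) + 2) ≤ a - 1 :=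
      fun n => hd.1 _ (by omega)
    have hfb : ∀ n : ℕ, 0 ≤ f ((n : ℤ) + 2) ∧ f ((n : ℤ) + 2) ≤ a - 1 :=
      fun n => hf.1 _ (by omega)
    have hE : ∀ n : ℕ, |d ((n : ℤ) + 2) - f ((n : ℤ) + 2)| ≤ a - 1 := by
      intro n
      have := hdb n
      have := hfb n
      rw [abs_le]; constructor <;> omega
    have hsd := summ (a - 1 : ℝ) α hn (fun n : ℕ => d ((n : ℤ) + 2)) (by
      intro n
      have h : |d ((n : ℤ) + 2)| ≤ a - 1 := by
        rw [abs_of_nonneg (hdb n).1]; exact (hdb n).2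
      exact_mod_cast h) 2
    have hsf := summ (a - 1 : ℝ) α hn (fun n : ℕ => f ((n : ℤ) + 2)) (by
      intro n
      have h : |f ((n : ℤ) + 2)| ≤ a - 1 := by
        rw [abs_of_nonneg (hfb n).1]; exact (hfb n).2
      exact_mod_cast h) 2
    have hsum : ∑' n : ℕ, ((d ((n : ℤ) + 2) - f ((n : ℤ) + 2) : ℤ) : ℂ) * α ^ (n + 2)
        = 1 - α ^ 2 := by
      have h1 : ∀ n : ℕ, ((d ((n : ℤ) + 2) - f ((n : ℤ) + 2) : ℤ) : ℂ) * α ^ (n + 2)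
          = (d ((n : ℤ) + 2) : ℂ) * α ^ (n + 2) - (f ((n : ℤ) + 2) : ℂ) * α ^ (n + 2) := by
        intro n; push_cast; ring
      simp only [h1]
      rw [hsd.tsum_sub hsf, ← hx, ← hy]
      linear_combination hxz - hyz
    obtain ⟨T, h0, h1, h2, hT⟩ := carry_rec a (fun n : ℕ => d ((n : ℤ) + 2) - f ((n : ℤ) + 2))
    have hbd := carry_bdd a α hroot hα hm (a - 1 : ℝ)
      (fun n : ℕ => d ((n : ℤ) + 2) - f ((n : ℤ) + 2)) T (by
        intro n; exact_mod_cast hE n) h0 h1 h2 hT hsum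
    have hper := aux_per a ha T h0 h1 h2 hbd (fun n => by rw [← hT n]; exact hE n)
    have hT4 : ∀ n : ℕ, T (n + 1) = if n % 4 = 0 ∨ n % 4 = 1 then 1 else -1 := by
      intro n
      induction n using Nat.twoStepInduction with
      | zero => simp [h1]
      | one => simp [h2]
      | more n ih _ =>
        have := (hper (n + 1)).2.2
        rw [show n + 2 + 1 = n + 1 + 2 by ring, this, ih]
        split_ifs <;> omega
    have hdper : ∀ n : ℕ, d ((n : ℤ) + 2) = per a 0 ((n : ℤ) + 2) := by
      intro n
      have e := hT n
      have p1 := (hper n).2.2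
      have p2 := (hper (n + 1)).2.2
      have p3 := hT4 n
      rw [show n + 1 + 2 = n + 3 by ring] at p2
      rw [p1, p2, p3] at e
      have := hdb n
      have := hfb n
      unfold per
      split_ifs at e ⊢ <;> omega
    have : x = - α ^ 2 := by
      rw [hx, vd]
      simp only [hdper]
    rw [← hxz, this]; ring
  · rintro rfl
    exact ⟨⟨⟨per a 1, per_adm a 1 ha, vc⟩, - α ^ 2, ⟨per a 0, per_adm a 0 ha, vd⟩, by ring⟩,
      ⟨⟨per a 1, per_adm a 1 ha, vc⟩, - 1, ⟨per a 2, per_adm a 2 ha, vf⟩, by ring⟩⟩
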